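/- For every positive even integer k, the congruence S_{k/2}⁴ ≡ ∑_{j=0}^{k/2} (k/2 + 1 − 2j² + jk) · S_{2j} (mod S_{k+1}) holds in ℤ[X]. (This is the fusion ring identity (τ_{k/2})⁴ = ∑_{j=0}^{k/2} (k/2+1−2j²+jk) τ_{2j} in R_k(SU(2)).) -/

import Mathlib

open Polynomial

/-- The polynomials `S_n ∈ ℤ[X]` with `S_0 = 1`, `S_1 = X`, `S_{n+1} = X·S_n − S_{n−1}`;
under `R(SU(2)) ≅ ℤ[X]`, the character `χ_n` corresponds to `S_n`, and the level `k`
fusion ring `R_k(SU(2))` is `ℤ[X]/(S_{k+1})`. -/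
noncomputable def chebS : ℕ → Polynomial ℤ
  | 0 => 1
  | 1 => Polynomial.X
  | (n + 2) => Polynomial.X * chebS (n + 1) - chebS n

theorem chebS_step (n : ℕ) : chebS (n + 2) = X * chebS (n + 1) - chebS n := by
  rw [chebS]

theorem chebS_zero : chebS 0 = 1 := by rw [chebS]

theorem chebS_one : chebS 1 = X := by rw [chebS]

theorem chebS_pyth (n : ℕ) :
    chebS n ^ 2 + chebS (n + 1) ^ 2 - X * chebS n * chebS (n + 1) = 1 := by
  induction n with
  | zero => rw [chebS_zero, zero_add, chebS_one]; ring
  | succ n ih => rw [chebS_step]; linear_combination ih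

theorem chebS_double (n : ℕ) :
    chebS (2 * n) = chebS n ^ 2 - (X * chebS n - chebS (n + 1)) ^ 2 ∧
      chebS (2 * n + 1) = chebS n * (2 * chebS (n + 1) - X * chebS n) := by
  induction n with
  | zero => simp only [mul_zero, zero_add, chebS_zero, chebS_one]; constructor <;> ring
  | succ n ih =>
    obtain ⟨h1, h2⟩ := ih
    have e1 : chebS (2 * (n + 1)) = X * chebS (2 * n + 1) - chebS (2 * n) := chebS_step (2 * n)
    have e2 : chebS (2 * (n + 1) + 1) = X * chebS (2 * (n + 1)) - chebS (2 * n + 1) :=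
      chebS_step (2 * n + 1)
    rw [e2, e1, h1, h2, chebS_step]
    constructor <;> ring

theorem chebS_odd_dvd (n : ℕ) :
    ((X : ℤ[X]) ^ 2 - 4 ∣ chebS (2 * n + 1) - ((n : ℤ[X]) + 1) * X) ∧
      ((X : ℤ[X]) ^ 2 - 4 ∣ chebS (2 * (n + 1) + 1) - ((n : ℤ[X]) + 2) * X) := by
  have st : ∀ n : ℕ, chebS (2 * n + 3) = X * chebS (2 * n + 2) - chebS (2 * n + 1) :=
    fun n => chebS_step (2 * n + 1)
  induction n with
  | zero =>
    have h3 := st 0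
    have h2 := chebS_step 0
    simp only [mul_zero, zero_add, chebS_zero, chebS_one, mul_one, Nat.cast_zero] at *
    refine ⟨by simp, ⟨X, ?_⟩⟩
    change chebS 3 - _ = _
    rw [h3, h2]; ring
  | succ n ih =>
    obtain ⟨⟨u, hu⟩, ⟨v, hv⟩⟩ := ih
    refine ⟨⟨v, ?_⟩, ⟨(X ^ 2 - 2) * v - u + ((n : ℤ[X]) + 2) * X, ?_⟩⟩
    · push_cast; linear_combination hv
    · have a1 : chebS (2 * (n + 1 + 1) + 1) =
          X * chebS (2 * (n + 1) + 2) - chebS (2 * (n + 1) + 1) := st (n + 1)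
      have a2 : chebS (2 * (n + 1) + 2) =
          X * chebS (2 * (n + 1) + 1) - chebS (2 * n + 2) := chebS_step (2 * n + 2)
      have a3 : chebS (2 * (n + 1) + 1) = X * chebS (2 * n + 2) - chebS (2 * n + 1) := st n
      push_cast
      linear_combination a1 + X * a2 + a3 + (X ^ 2 - 2) * hv - hu

theorem chebS_sum (m n : ℕ) :
    ((X : ℤ[X]) ^ 2 - 4) * ∑ j ∈ Finset.range (n + 1),
        ((m : ℤ[X]) + 1 + 2 * j * (m - j)) * chebS (2 * j) =
      ((m : ℤ[X]) + 1 + 2 * n * (m - n)) * chebS (2 * n + 2)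
        - ((m : ℤ[X]) + 1 + 2 * (n + 1) * (m - (n + 1))) * chebS (2 * n) - 4 * chebS n ^ 2 := by
  induction n with
  | zero =>
    have h2 := chebS_step 0
    simp only [mul_zero, zero_add, chebS_zero, chebS_one, Nat.cast_zero,
      Finset.sum_range_one] at *
    rw [h2]; ring
  | succ n ih =>
    rw [Finset.sum_range_succ, mul_add, ih]
    have d := (chebS_double (n + 1)).1
    rw [chebS_step n] at d
    have a1 : chebS (2 * (n + 1) + 2) = X * chebS (2 * n + 3) - chebS (2 * (n + 1)) :=
      chebS_step (2 * (n + 1))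
    have a2 : chebS (2 * n + 3) = X * chebS (2 * (n + 1)) - chebS (2 * n + 1) :=
      chebS_step (2 * n + 1)
    have a3 : chebS (2 * (n + 1)) = X * chebS (2 * n + 1) - chebS (2 * n) := chebS_step (2 * n)
    have a4 : chebS (2 * n + 2) = chebS (2 * (n + 1)) := rfl
    rw [a4, a1, a2]
    have a5 : chebS (2 * n) = X * chebS (2 * n + 1) - chebS (2 * (n + 1)) := by rw [a3]; ring
    rw [a5]
    push_cast
    linear_combination (-4) * d

/-- The fusion ring identity `(τ_{k/2})⁴ = ∑_{j=0}^{k/2} (k/2+1−2j²+jk) τ_{2j}` in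
`R_k(SU(2))`: for a positive even integer `k`,
`S_{k/2}⁴ ≡ ∑_{j=0}^{k/2} (k/2 + 1 − 2j² + jk)·S_{2j}  (mod S_{k+1})` in `ℤ[X]`. -/
theorem statement7 (k : ℕ) (hk : 0 < k) (hk2 : 2 ∣ k) :
    chebS (k + 1) ∣
      chebS (k / 2) ^ 4 -
        ∑ j ∈ Finset.range (k / 2 + 1),
          Polynomial.C (((k / 2 : ℕ) : ℤ) + 1 - 2 * (j : ℤ) ^ 2 + (j : ℤ) * (k : ℤ)) *
            chebS (2 * j) := by
  obtain ⟨m, rfl⟩ := hk2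
  have hm : 2 * m / 2 = m := by omega
  rw [hm]
  have hs : ∑ j ∈ Finset.range (m + 1),
      Polynomial.C ((m : ℤ) + 1 - 2 * (j : ℤ) ^ 2 + (j : ℤ) * ((2 * m : ℕ) : ℤ)) *
        chebS (2 * j) =
      ∑ j ∈ Finset.range (m + 1), ((m : ℤ[X]) + 1 + 2 * j * (m - j)) * chebS (2 * j) := by
    refine Finset.sum_congr rfl fun j _ => ?_
    congr 1
    simp
    ring
  rw [hs]
  have key := chebS_sum m m
  set T := ∑ j ∈ Finset.range (m + 1), ((m : ℤ[X]) + 1 + 2 * j * (m - j)) * chebS (2 * j)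
  obtain ⟨w, hw⟩ := (chebS_odd_dvd m).1
  have hne : (X : ℤ[X]) ^ 2 - 4 ≠ 0 := by
    intro h
    have := congrArg (Polynomial.eval 0) h
    simp at this
  refine ⟨w, mul_left_cancel₀ hne ?_⟩
  have p := chebS_pyth m
  have d := (chebS_double m).2
  have e := chebS_step (2 * m)
  have sq : chebS (2 * m + 1) ^ 2 = chebS m ^ 2 * ((X ^ 2 - 4) * chebS m ^ 2 + 4) := by
    rw [d]; linear_combination 4 * chebS m ^ 2 * p
  linear_combination -key + chebS (2 * m + 1) * hw - sq - ((m : ℤ[X]) + 1) * e
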